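/- Let m be a natural number and let x, y, z : Fin m → ℚ be three pairwise distinct points such that each of x, y, z is plus or minus a standard basis vector (i.e. for each of them there exists an index j with the j-th coordinate equal to 1 or -1 and all other coordinates equal to 0). Then x, y, z do not lie on a common affine line, i.e. ¬ Collinear ℚ {x, y, z}. -/

import Mathlib

/-- Three distinct points on a sphere centred at the origin are not collinear. -/
theorem not_collinear_of_dotProduct_self_eq {ι K : Type*} [Fintype ι] [Field K] [LinearOrder K]
    [IsStrictOrderedRing K] {x y z : ι → K} {c : K} (hx : x ⬝ᵥ x = c) (hy : y ⬝ᵥ y = c)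
    (hz : z ⬝ᵥ z = c) (hxy : x ≠ y) (hxz : x ≠ z) (hyz : y ≠ z) :
    ¬ Collinear K ({x, y, z} : Set (ι → K)) := by
  intro h
  obtain ⟨v, hv⟩ := (collinear_iff_of_mem (Set.mem_insert x _)).1 h
  obtain ⟨r, rfl⟩ := hv y (by simp)
  obtain ⟨s, rfl⟩ := hv z (by simp)
  have hr : r ≠ 0 := by rintro rfl; simp at hxy
  have hs : s ≠ 0 := by rintro rfl; simp at hxz
  have hrs : r - s ≠ 0 := sub_ne_zero.2 (by rintro rfl; exact hyz rfl)
  simp only [vadd_eq_add, add_dotProduct, dotProduct_add, smul_dotProduct, dotProduct_smul,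
    smul_eq_mul, dotProduct_comm x v] at hy hz
  have hr' : r * (v ⬝ᵥ v) + 2 * (v ⬝ᵥ x) = 0 :=
    mul_left_cancel₀ hr (by linear_combination hy - hx)
  have hs' : s * (v ⬝ᵥ v) + 2 * (v ⬝ᵥ x) = 0 :=
    mul_left_cancel₀ hs (by linear_combination hz - hx)
  have hvv : v ⬝ᵥ v = 0 := mul_left_cancel₀ hrs (by linear_combination hr' - hs')
  rw [dotProduct_self_eq_zero] at hvv
  simp [hvv] at hxy

theorem dotProduct_self_eq_one_of_pm_basis {ι R : Type*} [Fintype ι] [Ring R] {x : ι → R}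
    (hx : ∃ j, (x j = 1 ∨ x j = -1) ∧ ∀ i, i ≠ j → x i = 0) : x ⬝ᵥ x = 1 := by
  obtain ⟨j, hj, h⟩ := hx
  rw [dotProduct, Fintype.sum_eq_single j fun i hi => by simp [h i hi]]
  rcases hj with hj | hj <;> simp [hj]

theorem pm_basis_vectors_not_collinear (m : ℕ) (x y z : Fin m → ℚ)
    (hx : ∃ j, (x j = 1 ∨ x j = -1) ∧ ∀ i, i ≠ j → x i = 0)
    (hy : ∃ j, (y j = 1 ∨ y j = -1) ∧ ∀ i, i ≠ j → y i = 0)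
    (hz : ∃ j, (z j = 1 ∨ z j = -1) ∧ ∀ i, i ≠ j → z i = 0)
    (hxy : x ≠ y) (hxz : x ≠ z) (hyz : y ≠ z) :
    ¬ Collinear ℚ ({x, y, z} : Set (Fin m → ℚ)) :=
  not_collinear_of_dotProduct_self_eq (dotProduct_self_eq_one_of_pm_basis hx)
    (dotProduct_self_eq_one_of_pm_basis hy) (dotProduct_self_eq_one_of_pm_basis hz) hxy hxz hyz
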